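/- For n ≥ 1, the ideal J_{n,n} of ℚ[x_1,…,x_n] equals the classical invariant ideal ⟨e_1, e_2, …, e_n⟩ generated by the elementary symmetric polynomials; consequently S_{n,n} equals the classical coinvariant algebra R_{n,n} = ℚ[x_1,…,x_n]/⟨e_1,…,e_n⟩. -/

import Mathlib

open scoped BigOperators

namespace PackedWords

/-- An ordered set partition of `[n] = {1, …, n}` with `k` blocks: a sequence
`B_1 | ⋯ | B_k` of nonempty pairwise disjoint subsets of `[n]` whose union is `[n]`. -/
structure OSP (n k : ℕ) where
  blocks : Fin k → Finset ℕ
  subset_range : ∀ j, blocks j ⊆ Finset.Icc 1 n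
  blocks_nonempty : ∀ j, (blocks j).Nonempty
  blocks_disjoint : ∀ j₁ j₂ : Fin k, j₁ ≠ j₂ → Disjoint (blocks j₁) (blocks j₂)
  cover : ∀ i ∈ Finset.Icc 1 n, ∃ j, i ∈ blocks j

/-- Common generalization of the coinversion code (`b = 0`) and the boosted
coinversion code (`b = 1`).  Position `p : Fin n` corresponds to the letter
`i = p + 1` of `[n]`.  If `i ∈ B_j` (blocks indexed `0, …, k-1`, so `j` here is
the paper's `j - 1`), then `c_i = #{ℓ > j : min B_ℓ > i}` if `i = min B_j`, and
`c_i = #{ℓ > j : min B_ℓ > i} + (j - 1) + b` (in the paper's 1-indexing) otherwise. -/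
noncomputable def codeAux {n k : ℕ} (b : ℕ) (σ : OSP n k) (p : Fin n) : ℕ :=
  if h : ∃ j, ((p : ℕ) + 1) ∈ σ.blocks j then
    (Finset.univ.filter fun ℓ : Fin k =>
        h.choose < ℓ ∧ ∀ x ∈ σ.blocks ℓ, (p : ℕ) + 1 < x).card
      + (if ∀ x ∈ σ.blocks h.choose, (p : ℕ) + 1 ≤ x then 0 else (h.choose : ℕ) + b)
  else 0

/-- The coinversion code of an ordered set partition. -/
noncomputable def code {n k : ℕ} (σ : OSP n k) : Fin n → ℕ := codeAux 0 σ

/-- The boosted coinversion code of an ordered set partition. -/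
noncomputable def bcode {n k : ℕ} (σ : OSP n k) : Fin n → ℕ := codeAux 1 σ

/-- The skip sequence of a finite set `S = {s_1 < s_2 < ⋯} ⊆ ℕ`:
`γ_i = i - j + 1` if `i = s_j ∈ S`, and `γ_i = 0` otherwise. -/
def skip (S : Finset ℕ) (i : ℕ) : ℕ :=
  if i ∈ S then i - (S.filter (· < i)).card else 0

/-- The reverse skip sequence `γ(S)* = (γ_n, …, γ_1)` of `S ⊆ [n]`, read at
position `p : Fin n` (so position `p` carries `γ_{n - p}` in 1-indexed terms). -/
def revSkipAt (n : ℕ) (S : Finset ℕ) (p : Fin n) : ℕ := skip S (n - (p : ℕ))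

/-- For `T ⊆ [n-1]` with skip sequence `γ = γ(T)`, the length-`n` sequence
`(γ_{n-1}, …, γ_i, d, γ_{i-1}, …, γ_1)` obtained from the reverse skip sequence of `T`
by inserting `d` in position `n - i + 1` (1-indexed), read at position `p : Fin n`. -/
def insSeq (n i d : ℕ) (T : Finset ℕ) (p : Fin n) : ℕ :=
  if (p : ℕ) + 1 ≤ n - i then skip T (n - ((p : ℕ) + 1))
  else if (p : ℕ) + 1 = n - i + 1 then d
  else skip T (n - ((p : ℕ) + 1) + 1)

/-- `Packedk n k w`: `w` is a packed word of length `n` on the alphabet of positive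
integers (whenever `i + 1` appears as a letter, so does `i`) in which each of the
letters `1, 2, …, k` appears. -/
def Packedk (n k : ℕ) (w : Fin n → ℕ) : Prop :=
  (∀ p, 1 ≤ w p) ∧ (∀ i, 1 ≤ i → (∃ p, w p = i + 1) → ∃ p, w p = i) ∧
    (∀ j, 1 ≤ j → j ≤ k → ∃ p, w p = j)

/-- The elementary symmetric polynomial of degree `a` in the variables `X j`, `j ∈ s`. -/
noncomputable def esymmOn (n : ℕ) (s : Finset (Fin n)) (a : ℕ) : MvPolynomial (Fin n) ℚ :=
  ∑ t ∈ s.powersetCard a, ∏ j ∈ t, MvPolynomial.X j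

/-- The complete homogeneous symmetric polynomial of degree `b` evaluated at
`α 1, α 2, …, α d`. -/
noncomputable def hval (b d : ℕ) (α : ℕ → ℚ) : ℚ :=
  ∑ m : Sym (Fin d) b, ((m : Multiset (Fin d)).map fun j => α ((j : ℕ) + 1)).prod

/-- The locus `X_{n,k} ⊆ ℚ^n` of points `(α_{w_1}, …, α_{w_n})` for `w ∈ W_{n,k}`. -/
def packedPoints (n k : ℕ) (α : ℕ → ℚ) : Set (Fin n → ℚ) :=
  {x | ∃ w : Fin n → ℕ, Packedk n k w ∧ x = fun p => α (w p)}

/-- The ideal `J_n = ⟨x_i^d e_{n-r}^{(i)} : 1 ≤ i ≤ n, 1 ≤ r ≤ d⟩`. -/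
noncomputable def Jn (n : ℕ) : Ideal (MvPolynomial (Fin n) ℚ) :=
  Ideal.span {g | ∃ (i : Fin n) (r d : ℕ), 1 ≤ r ∧ r ≤ d ∧
    g = MvPolynomial.X i ^ d * esymmOn n {i}ᶜ (n - r)}

/-- The ideal `J_{n,k} = J_n + ⟨e_n, e_{n-1}, …, e_{n-k+1}⟩`. -/
noncomputable def Jnk (n k : ℕ) : Ideal (MvPolynomial (Fin n) ℚ) :=
  Jn n ⊔ Ideal.span {g | ∃ j : ℕ, n - k + 1 ≤ j ∧ j ≤ n ∧ g = esymmOn n Finset.univ j}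

/-- The Haglund–Rhoades–Shimozono ideal
`I_{n,k} = ⟨x_1^k, …, x_n^k, e_n, e_{n-1}, …, e_{n-k+1}⟩`. -/
noncomputable def Ink (n k : ℕ) : Ideal (MvPolynomial (Fin n) ℚ) :=
  Ideal.span ({g | ∃ i : Fin n, g = MvPolynomial.X i ^ k} ∪
    {g | ∃ j : ℕ, n - k + 1 ≤ j ∧ j ≤ n ∧ g = esymmOn n Finset.univ j})

/-- `T(X)`: the ideal generated by the top-degree homogeneous components `τ(f)` of
all nonzero polynomials `f` vanishing on `X`. -/
noncomputable def gradedIdeal (n : ℕ) (X : Set (Fin n → ℚ)) : Ideal (MvPolynomial (Fin n) ℚ) :=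
  Ideal.span {g | ∃ f : MvPolynomial (Fin n) ℚ, f ≠ 0 ∧
    (∀ x ∈ X, MvPolynomial.eval x f = 0) ∧
    g = MvPolynomial.homogeneousComponent f.totalDegree f}

/-- The degree-`d` homogeneous component of the quotient `ℚ[x_1, …, x_n]/I`,
namely the image of the space of homogeneous polynomials of degree `d`. -/
noncomputable def quotComp (n : ℕ) (I : Ideal (MvPolynomial (Fin n) ℚ)) (d : ℕ) :
    Submodule ℚ (MvPolynomial (Fin n) ℚ ⧸ I) :=
  Submodule.map (Ideal.Quotient.mkₐ ℚ I).toLinearMap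
    (MvPolynomial.homogeneousSubmodule (Fin n) ℚ d)

/-- The degree-`(d - a)` homogeneous component of `ℚ[x_1, …, x_n]/I`, interpreted as
zero when `d - a < 0` (degree shift by `a`). -/
noncomputable def quotCompShift (n : ℕ) (I : Ideal (MvPolynomial (Fin n) ℚ)) (d a : ℕ) :
    Submodule ℚ (MvPolynomial (Fin n) ℚ ⧸ I) :=
  if a ≤ d then quotComp n I (d - a) else ⊥

lemma packedk_comp {n k : ℕ} {w : Fin n → ℕ} (σ : Equiv.Perm (Fin n)) (h : Packedk n k w) :
    Packedk n k (w ∘ σ) := by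
  obtain ⟨h1, h2, h3⟩ := h
  refine ⟨fun p => h1 _, fun i hi hex => ?_, fun j hj hjk => ?_⟩
  · obtain ⟨q, hq⟩ := h2 i hi (by obtain ⟨p, hp⟩ := hex; exact ⟨σ p, hp⟩)
    exact ⟨σ.symm q, by simpa using hq⟩
  · obtain ⟨q, hq⟩ := h3 j hj hjk
    exact ⟨σ.symm q, by simpa using hq⟩

/-- The left action of a permutation `σ ∈ S_n` on packed words, sending `w` to
`w ∘ σ⁻¹` (the permutation action on positions). -/
noncomputable def wordPerm (n k : ℕ) (σ : Equiv.Perm (Fin n)) :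
    {w : Fin n → ℕ // Packedk n k w} ≃ {w : Fin n → ℕ // Packedk n k w} where
  toFun w := ⟨w.1 ∘ σ.symm, packedk_comp σ.symm w.2⟩
  invFun w := ⟨w.1 ∘ σ, packedk_comp σ w.2⟩
  left_inv w := Subtype.ext (funext fun p => by simp)
  right_inv w := Subtype.ext (funext fun p => by simp)

/-- The invariant ideal `⟨e_1, …, e_n⟩`. -/
noncomputable def invariantIdeal (n : ℕ) : Ideal (MvPolynomial (Fin n) ℚ) :=
  Ideal.span {g | ∃ j : ℕ, 1 ≤ j ∧ j ≤ n ∧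
    g = esymmOn n (Finset.univ : Finset (Fin n)) j}

lemma esymmOn_zero (n : ℕ) (s : Finset (Fin n)) : esymmOn n s 0 = 1 := by
  simp [esymmOn]

lemma esymmOn_eq_zero_of_card_lt {n a : ℕ} {s : Finset (Fin n)} (h : s.card < a) :
    esymmOn n s a = 0 := by
  simp [esymmOn, Finset.powersetCard_eq_empty.mpr h]

lemma esymmOn_insert_succ {n : ℕ} {s : Finset (Fin n)} {i : Fin n} (hi : i ∉ s) (a : ℕ) :
    esymmOn n (insert i s) (a + 1) =
      esymmOn n s (a + 1) + MvPolynomial.X i * esymmOn n s a := by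
  have hmem : ∀ t ∈ s.powersetCard a, i ∉ t := fun t ht hit =>
    hi ((Finset.mem_powersetCard.mp ht).1 hit)
  unfold esymmOn
  rw [Finset.powersetCard_succ_insert hi, Finset.sum_union, Finset.sum_image, Finset.mul_sum]
  · congr 1
    exact Finset.sum_congr rfl fun t ht => Finset.prod_insert (hmem t ht)
  · intro t ht u hu htu
    rw [← Finset.erase_insert (hmem t ht), ← Finset.erase_insert (hmem u hu), htu]
  · rw [Finset.disjoint_left]
    intro t ht htu
    obtain ⟨u, -, rfl⟩ := Finset.mem_image.mp htu
    exact hi ((Finset.mem_powersetCard.mp ht).1 (Finset.mem_insert_self i u))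

lemma esymmOn_univ_succ {n : ℕ} (i : Fin n) (a : ℕ) :
    esymmOn n Finset.univ (a + 1) =
      esymmOn n {i}ᶜ (a + 1) + MvPolynomial.X i * esymmOn n {i}ᶜ a := by
  rw [← esymmOn_insert_succ (by simp)]
  congr 1
  ext j
  simp

lemma esymmOn_univ_succ_mem_invariantIdeal (n a : ℕ) :
    esymmOn n Finset.univ (a + 1) ∈ invariantIdeal n := by
  by_cases h : a + 1 ≤ n
  · exact Ideal.subset_span ⟨a + 1, by omega, h, rfl⟩
  · rw [esymmOn_eq_zero_of_card_lt (by simpa using h)]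
    exact zero_mem _

/-- Modulo the invariant ideal, `e_a^{(i)} = (-x_i)^a`. -/
lemma esymmOn_compl_sub_mem_invariantIdeal {n : ℕ} (i : Fin n) (a : ℕ) :
    esymmOn n {i}ᶜ a - (-MvPolynomial.X i) ^ a ∈ invariantIdeal n := by
  induction a with
  | zero => simp [esymmOn_zero]
  | succ a ih =>
    have h := sub_mem (esymmOn_univ_succ_mem_invariantIdeal n a)
      (Ideal.mul_mem_left _ (MvPolynomial.X i) ih)
    rw [esymmOn_univ_succ i a] at h
    convert h using 1
    ring

lemma X_pow_mem_invariantIdeal {n m : ℕ} (i : Fin n) (h : n ≤ m) :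
    (MvPolynomial.X i : MvPolynomial (Fin n) ℚ) ^ m ∈ invariantIdeal n := by
  refine Ideal.mem_of_dvd _ (pow_dvd_pow _ h) ?_
  have hn := esymmOn_compl_sub_mem_invariantIdeal i n
  rw [esymmOn_eq_zero_of_card_lt (by have := i.pos; simp [Finset.card_compl]; omega), zero_sub,
    neg_mem_iff, neg_pow] at hn
  have h' := Ideal.mul_mem_left _ ((-1 : MvPolynomial (Fin n) ℚ) ^ n) hn
  rwa [← mul_assoc, ← mul_pow, neg_one_mul, neg_neg, one_pow, one_mul] at h'

lemma Jn_le_invariantIdeal (n : ℕ) : Jn n ≤ invariantIdeal n := by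
  refine Ideal.span_le.mpr ?_
  rintro _ ⟨i, r, d, -, hrd, rfl⟩
  have h := add_mem
    (Ideal.mul_mem_left _ (MvPolynomial.X i ^ d)
      (esymmOn_compl_sub_mem_invariantIdeal i (n - r)))
    (Ideal.mul_mem_left _ ((-1) ^ (n - r))
      (X_pow_mem_invariantIdeal i (show n ≤ d + (n - r) by omega)))
  rw [SetLike.mem_coe]
  convert h using 1
  rw [neg_pow]
  ring

/-- for `n ≥ 1`, the ideal `J_{n,n}` equals the classical invariant ideal
`⟨e_1, e_2, …, e_n⟩`; consequently `S_{n,n}` is the classical coinvariant algebra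
`R_{n,n} = ℚ[x_1, …, x_n]/⟨e_1, …, e_n⟩`. -/
theorem Jnn_eq_invariant_ideal (n : ℕ) (hn : 1 ≤ n) :
    Jnk n n = Ideal.span {g | ∃ j : ℕ, 1 ≤ j ∧ j ≤ n ∧
      g = esymmOn n (Finset.univ : Finset (Fin n)) j} := by
  unfold Jnk
  simp only [Nat.sub_self, zero_add]
  exact sup_eq_right.mpr (Jn_le_invariantIdeal n)

end PackedWords
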